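/- arXiv:2006.04659 — 2 statements merged into one kernel-verified Lean document; each statement's English description precedes it below -/
import Mathlib

section
/- Factorization in the Mellin space (asymmetric model): let α > 0, β ∈ (−α, 0), δ > 0, μ ∈ ℝ, γ := √(α²−β²). Let P : (0,∞) → [0,∞) be a measurable payoff such that P(S_t e^{(r−q+ω)τ + x}) = 0 for x ≤ μτ, and suppose the payoff Mellin transform P*(s₁,s₂) := ∫_{μτ}^∞ P(S_t e^{(r−q+ω)τ + x}) (x−μτ)^{−s₁−s₂} dx converges absolutely for (Re(s₁), Re(s₂)) in some nonempty subset P̃ of (0,∞)². Fix (c₁,c₂) ∈ P̃ and assume the corresponding triple integral over (x,u₁,u₂) is absolutely convergent. Then the option price C := e^{−rτ} ∫_ℝ P(S_t e^{(r−q+ω)τ + x}) f(x,τ) dx satisfies C = (α/(2π)) e^{(γδ−r)τ} · (1/(2π))² ∫_ℝ ∫_ℝ (−β)^{−(c₂+iu₂)} Γ((c₁+iu₁)/2) Γ(c₂+iu₂) P*(c₁+iu₁, c₂+iu₂) K_{1−(c₁+iu₁)/2}(αδτ) (2δτ/α)^{(c₁+iu₁)/2} du₁ du₂. -/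
open MeasureTheory

/-- Modified Bessel function of the second kind, real index `ν`, real argument `z`. -/
noncomputable def besselKr (ν : ℝ) (z : ℝ) : ℝ :=
  (1 / 2) * (z / 2) ^ ν *
    ∫ t in Set.Ioi (0 : ℝ), Real.exp (-t - z ^ 2 / (4 * t)) * t ^ (-ν - 1)

/-- Asymmetric NIG density at time `t`. -/
noncomputable def nigDensityA (α β δ μ x t : ℝ) : ℝ :=
  (α * δ * t / Real.pi) * Real.exp (Real.sqrt (α ^ 2 - β ^ 2) * δ * t + β * (x - μ * t)) *
    besselKr 1 (α * Real.sqrt ((δ * t) ^ 2 + (x - μ * t) ^ 2)) /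
    Real.sqrt ((δ * t) ^ 2 + (x - μ * t) ^ 2)

/-- Modified Bessel function of the second kind, complex index `ν`, real argument `z`. -/
noncomputable def besselK (ν : ℂ) (z : ℝ) : ℂ :=
  (1 / 2) * ((z : ℂ) / 2) ^ ν *
    ∫ t in Set.Ioi (0 : ℝ), Complex.exp (-(t : ℂ) - (z : ℂ) ^ 2 / (4 * (t : ℂ))) *
      (t : ℂ) ^ (-ν - 1)

lemma aux_cpow (x : ℝ) (hx : 0 < x) (s : ℂ) :
    (x : ℂ) ^ s = Complex.exp ((Real.log x : ℂ) * s) := by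
  rw [Complex.cpow_def_of_ne_zero (by exact_mod_cast hx.ne'), Complex.ofReal_log hx.le]

lemma aux_norm_Gamma (s : ℂ) (hs : 0 < s.re) : ‖Complex.Gamma s‖ ≤ Real.Gamma s.re := by
  rw [Complex.Gamma_eq_integral hs, Real.Gamma_eq_integral hs, Complex.GammaIntegral]
  refine (norm_integral_le_integral_norm _).trans (le_of_eq ?_)
  refine setIntegral_congr_fun measurableSet_Ioi fun t ht => ?_
  have ht' : (0 : ℝ) < t := ht
  simp only [norm_mul]
  rw [Complex.norm_cpow_eq_rpow_re_of_pos ht', Complex.norm_of_nonneg (Real.exp_pos _).le]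
  simp

lemma aux_Gamma_cont (c : ℝ) (hc : 0 < c) :
    Continuous (fun u : ℝ => Complex.Gamma ((c : ℂ) + (u : ℂ) * Complex.I)) := by
  rw [continuous_iff_continuousAt]
  intro u
  refine ContinuousAt.comp (f := fun u : ℝ => (c : ℂ) + (u : ℂ) * Complex.I) (g := Complex.Gamma)
    (Complex.continuousAt_Gamma _ ?_) (by fun_prop)
  intro m h
  have := congrArg Complex.re h
  simp at this
  have : (0 : ℝ) ≤ m := Nat.cast_nonneg m
  linarith

lemma aux_Gamma_int (c : ℝ) (hc : 0 < c) :
    Integrable (fun u : ℝ => Complex.Gamma ((c : ℂ) + (u : ℂ) * Complex.I)) := by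
  have hm : 0 < min c 1 := lt_min hc one_pos
  refine (integrable_inv_one_add_sq.const_mul (Real.Gamma (c + 2) / min c 1)).mono'
    (aux_Gamma_cont c hc).aestronglyMeasurable (Filter.Eventually.of_forall fun u => ?_)
  set s : ℂ := (c : ℂ) + (u : ℂ) * Complex.I with hsdef
  have hre : s.re = c := by simp [s]
  have him : s.im = u := by simp [s]
  have hs0 : s ≠ 0 := by
    intro h
    rw [h] at hre; simp at hre; linarith
  have hs1 : s + 1 ≠ 0 := by
    intro h
    have := congrArg Complex.re h
    simp [hre] at this; linarith
  have h2 : Complex.Gamma (s + 1 + 1) = (s + 1) * (s * Complex.Gamma s) := by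
    rw [Complex.Gamma_add_one _ hs1, Complex.Gamma_add_one _ hs0]
  have h3 : ‖Complex.Gamma (s + 1 + 1)‖ ≤ Real.Gamma (c + 2) := by
    have := aux_norm_Gamma (s + 1 + 1) (by simp [hre]; linarith)
    have e : (s + 1 + 1).re = c + 2 := by simp [hre]; ring
    rwa [e] at this
  rw [h2, norm_mul, norm_mul] at h3
  have n1 : Real.sqrt (1 + u ^ 2) ≤ ‖s + 1‖ := by
    rw [Complex.norm_eq_sqrt_sq_add_sq]
    apply Real.sqrt_le_sqrt
    simp only [Complex.add_re, Complex.one_re, Complex.add_im, Complex.one_im, hre, him, add_zero]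
    nlinarith
  have n0 : min c 1 * Real.sqrt (1 + u ^ 2) ≤ ‖s‖ := by
    rw [Complex.norm_eq_sqrt_sq_add_sq, hre, him]
    apply Real.le_sqrt_of_sq_le
    rw [mul_pow, Real.sq_sqrt (by positivity)]
    have a1 : (min c 1) ^ 2 ≤ c ^ 2 := pow_le_pow_left₀ hm.le (min_le_left _ _) 2
    have a2 : (min c 1) ^ 2 ≤ 1 ^ 2 := pow_le_pow_left₀ hm.le (min_le_right _ _) 2
    nlinarith [sq_nonneg u]
  have hq : Real.sqrt (1 + u ^ 2) * Real.sqrt (1 + u ^ 2) = 1 + u ^ 2 :=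
    Real.mul_self_sqrt (by positivity)
  have h4 : (min c 1 * (1 + u ^ 2)) * ‖Complex.Gamma s‖ ≤ Real.Gamma (c + 2) := by
    refine le_trans ?_ h3
    rw [← mul_assoc]
    refine mul_le_mul_of_nonneg_right ?_ (norm_nonneg _)
    calc min c 1 * (1 + u ^ 2) = Real.sqrt (1 + u ^ 2) * (min c 1 * Real.sqrt (1 + u ^ 2)) := by
          linear_combination (-min c 1) * hq
      _ ≤ _ := mul_le_mul n1 n0 (by positivity) (by positivity)
  have hp : 0 < min c 1 * (1 + u ^ 2) := by positivity
  rw [← div_eq_mul_inv, div_div, le_div_iff₀ hp]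
  linarith

lemma aux_mellin_exp (c : ℝ) (hc : 0 < c) (x : ℝ) (hx : 0 < x) :
    ∫ u : ℝ, (x : ℂ) ^ (-((c : ℂ) + (u : ℂ) * Complex.I)) *
      Complex.Gamma ((c : ℂ) + (u : ℂ) * Complex.I) = 2 * Real.pi * (Real.exp (-x) : ℂ) := by
  have hG : ∀ u : ℝ, mellin (fun x : ℝ => ((Real.exp (-x) : ℝ) : ℂ)) ((c : ℂ) + (u : ℂ) * Complex.I)
      = Complex.Gamma ((c : ℂ) + (u : ℂ) * Complex.I) := by
    intro u
    rw [Complex.Gamma_eq_integral (by simpa using hc), Complex.GammaIntegral_eq_mellin]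
  have h := mellinInv_mellin_eq c (fun x : ℝ => ((Real.exp (-x) : ℝ) : ℂ)) hx
    (by
      have := Complex.GammaIntegral_convergent (s := (c : ℂ)) (by simpa using hc)
      refine this.congr_fun (fun t _ => ?_) measurableSet_Ioi
      simp [mul_comm])
    (by
      unfold Complex.VerticalIntegrable
      simp only [hG]
      exact aux_Gamma_int c hc)
    (by fun_prop)
  unfold mellinInv at h
  simp only [hG, smul_eq_mul] at h
  rw [← h]
  have : (Real.pi : ℂ) ≠ 0 := by exact_mod_cast Real.pi_ne_zero
  rw [Complex.real_smul]
  push_cast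
  rw [← mul_assoc, mul_one_div_cancel (by simp [this]), one_mul]

lemma aux_int_exp (a p : ℝ) (ha : 0 < a) :
    IntegrableOn (fun t : ℝ => Real.exp (-t - a / t) * t ^ p) (Set.Ioi 0) := by
  obtain ⟨n, hn⟩ := exists_nat_gt (-p)
  have h := (Real.GammaIntegral_convergent (s := n + p + 1) (by linarith)).const_mul
    ((n.factorial : ℝ) / a ^ n)
  refine Integrable.mono' h ?_ ?_
  · refine Measurable.aestronglyMeasurable ?_
    fun_prop
  · refine (ae_restrict_iff' measurableSet_Ioi).mpr (Filter.Eventually.of_forall fun t ht => ?_)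
    have ht' : (0 : ℝ) < t := ht
    rw [Real.norm_of_nonneg (by positivity)]
    have h1 : (a / t) ^ n / n.factorial ≤ Real.exp (a / t) :=
      Real.pow_div_factorial_le_exp _ (by positivity) n
    have h2 : Real.exp (-(a / t)) ≤ (n.factorial : ℝ) / a ^ n * t ^ n := by
      rw [Real.exp_neg]
      refine (inv_anti₀ (by positivity) h1).trans (le_of_eq ?_)
      rw [div_pow]; field_simp
    have e : (n : ℝ) + p + 1 - 1 = n + p := by ring
    rw [e, Real.rpow_add ht', Real.rpow_natCast, sub_eq_add_neg, Real.exp_add]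
    calc Real.exp (-t) * Real.exp (-(a / t)) * t ^ p
        ≤ Real.exp (-t) * ((n.factorial : ℝ) / a ^ n * t ^ n) * t ^ p := by gcongr
      _ = _ := by ring

lemma aux_Gamma_half (c : ℝ) (u : ℝ) :
    ((c : ℂ) + (u : ℂ) * Complex.I) / 2 = ((c / 2 : ℝ) : ℂ) + ((u * (1 / 2) : ℝ) : ℂ) * Complex.I := by
  push_cast; ring

lemma aux_mellin_half (c : ℝ) (hc : 0 < c) (x : ℝ) (hx : 0 < x) :
    ∫ u : ℝ, (x : ℂ) ^ (-(((c : ℂ) + (u : ℂ) * Complex.I) / 2)) *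
      Complex.Gamma (((c : ℂ) + (u : ℂ) * Complex.I) / 2)
      = 4 * Real.pi * (Real.exp (-x) : ℂ) := by
  simp only [aux_Gamma_half]
  rw [Measure.integral_comp_mul_right (fun u : ℝ => (x : ℂ) ^ (-(((c / 2 : ℝ) : ℂ) + (u : ℂ) * Complex.I)) *
      Complex.Gamma (((c / 2 : ℝ) : ℂ) + (u : ℂ) * Complex.I)) (1 / 2),
    aux_mellin_exp (c / 2) (by positivity) x hx, Complex.real_smul]
  norm_num
  ring

lemma aux_mellin_scaled (c : ℝ) (hc : 0 < c) (b y : ℝ) (hb : 0 < b) (hy : 0 < y) :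
    ∫ u : ℝ, (y : ℂ) ^ (-((c : ℂ) + (u : ℂ) * Complex.I)) *
      ((b : ℂ) ^ (-((c : ℂ) + (u : ℂ) * Complex.I)) *
      Complex.Gamma ((c : ℂ) + (u : ℂ) * Complex.I)) = 2 * Real.pi * (Real.exp (-(b * y)) : ℂ) := by
  rw [← aux_mellin_exp c hc (b * y) (by positivity)]
  congr 1
  ext u
  rw [← mul_assoc, aux_cpow _ hy, aux_cpow _ hb, aux_cpow _ (mul_pos hb hy), ← Complex.exp_add,
    Real.log_mul hb.ne' hy.ne']
  congr 2
  push_cast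
  ring

lemma aux_power (α T y t : ℝ) (hα : 0 < α) (hT : 0 < T) (hy : 0 < y) (ht : 0 < t) (s : ℂ) :
    (y : ℂ) ^ (-s) * (((α * T : ℝ) : ℂ) / 2) ^ (1 - s / 2) * ((2 * T / α : ℝ) : ℂ) ^ (s / 2) *
      (t : ℂ) ^ (-(1 - s / 2) - 1)
    = (α * T / 2 : ℝ) * ((t ^ (-2 : ℝ) : ℝ) : ℂ) *
      ((α ^ 2 * y ^ 2 / (4 * t) : ℝ) : ℂ) ^ (-(s / 2)) := by
  have e1 : (((α * T : ℝ) : ℂ) / 2) = ((α * T / 2 : ℝ) : ℂ) := by push_cast; ring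
  have e2 : ((α * T / 2 : ℝ) : ℂ) = ((α * T / 2 : ℝ) : ℂ) ^ (1 : ℂ) := by simp
  rw [e1, Complex.ofReal_cpow ht.le]
  conv_rhs => rw [e2]
  rw [aux_cpow y hy, aux_cpow _ (by positivity), aux_cpow _ (by positivity), aux_cpow _ ht,
    aux_cpow _ (by positivity), aux_cpow _ ht, aux_cpow _ (by positivity)]
  simp only [← Complex.exp_add]
  rw [Real.log_div (by positivity) (by positivity), Real.log_div (by positivity) (by positivity),
    Real.log_div (by positivity) (by positivity), Real.log_mul (by positivity) (by positivity),
    Real.log_mul (by positivity) (by positivity), Real.log_mul (by positivity) (by positivity),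
    Real.log_mul (by positivity) (by positivity), Real.log_pow, Real.log_pow,
    show (4 : ℝ) = 2 ^ 2 by norm_num, Real.log_pow]
  congr 1
  push_cast
  ring

lemma aux_bessel_one (α T y : ℝ) (hα : 0 < α) (hT : 0 < T) :
    besselKr 1 (α * Real.sqrt (T ^ 2 + y ^ 2)) / Real.sqrt (T ^ 2 + y ^ 2)
      = α / 4 * ∫ t in Set.Ioi (0 : ℝ), Real.exp (-t - (α * T) ^ 2 / 4 / t) * t ^ (-2 : ℝ) *
        Real.exp (-(α ^ 2 * y ^ 2 / (4 * t))) := by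
  have hk : 0 < Real.sqrt (T ^ 2 + y ^ 2) := Real.sqrt_pos.mpr (by positivity)
  have hk2 : Real.sqrt (T ^ 2 + y ^ 2) ^ 2 = T ^ 2 + y ^ 2 := Real.sq_sqrt (by positivity)
  have hI : (∫ t in Set.Ioi (0 : ℝ), Real.exp (-t - (α * Real.sqrt (T ^ 2 + y ^ 2)) ^ 2 / (4 * t))
        * t ^ (-1 - 1 : ℝ))
      = ∫ t in Set.Ioi (0 : ℝ), Real.exp (-t - (α * T) ^ 2 / 4 / t) * t ^ (-2 : ℝ) *
        Real.exp (-(α ^ 2 * y ^ 2 / (4 * t))) := by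
    refine setIntegral_congr_fun measurableSet_Ioi fun t ht => ?_
    have ht' : (0 : ℝ) < t := ht
    rw [mul_right_comm, ← Real.exp_add, show (-1 - 1 : ℝ) = -2 by norm_num, mul_pow, hk2]
    congr 2
    field_simp
    ring
  unfold besselKr
  rw [hI, Real.rpow_one]
  generalize (∫ t in Set.Ioi (0 : ℝ), Real.exp (-t - (α * T) ^ 2 / 4 / t) * t ^ (-2 : ℝ) *
        Real.exp (-(α ^ 2 * y ^ 2 / (4 * t)))) = J
  field_simp
  ring

lemma aux_fst (α T y c : ℝ) (hα : 0 < α) (hT : 0 < T) (hy : 0 < y) (hc : 0 < c) :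
    ∫ u : ℝ, (y : ℂ) ^ (-((c : ℂ) + (u : ℂ) * Complex.I)) *
      (Complex.Gamma (((c : ℂ) + (u : ℂ) * Complex.I) / 2) *
        besselK (1 - ((c : ℂ) + (u : ℂ) * Complex.I) / 2) (α * T) *
        ((2 * T / α : ℝ) : ℂ) ^ (((c : ℂ) + (u : ℂ) * Complex.I) / 2))
    = 4 * Real.pi * T * ((besselKr 1 (α * Real.sqrt (T ^ 2 + y ^ 2)) /
        Real.sqrt (T ^ 2 + y ^ 2) : ℝ) : ℂ) := by
  -- the joint integrand
  let Φ : ℝ → ℝ → ℂ := fun u t =>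
    ((α * T / 4 : ℝ) : ℂ) * ((Real.exp (-t - (α * T) ^ 2 / 4 / t) * t ^ (-2 : ℝ) : ℝ) : ℂ) *
      (((α ^ 2 * y ^ 2 / (4 * t) : ℝ) : ℂ) ^ (-(((c : ℂ) + (u : ℂ) * Complex.I) / 2)) *
      Complex.Gamma (((c : ℂ) + (u : ℂ) * Complex.I) / 2))
  have h1 : ∀ u : ℝ, (y : ℂ) ^ (-((c : ℂ) + (u : ℂ) * Complex.I)) *
      (Complex.Gamma (((c : ℂ) + (u : ℂ) * Complex.I) / 2) *
        besselK (1 - ((c : ℂ) + (u : ℂ) * Complex.I) / 2) (α * T) *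
        ((2 * T / α : ℝ) : ℂ) ^ (((c : ℂ) + (u : ℂ) * Complex.I) / 2))
      = ∫ t in Set.Ioi (0 : ℝ), Φ u t := by
    intro u
    unfold besselK
    set s : ℂ := (c : ℂ) + (u : ℂ) * Complex.I with hs
    set I := ∫ t in Set.Ioi (0 : ℝ), Complex.exp (-(t : ℂ) - ((α * T : ℝ) : ℂ) ^ 2 / (4 * (t : ℂ))) *
      (t : ℂ) ^ (-(1 - s / 2) - 1) with hI
    trans ((y : ℂ) ^ (-s) * (((α * T : ℝ) : ℂ) / 2) ^ (1 - s / 2) *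
      ((2 * T / α : ℝ) : ℂ) ^ (s / 2) * (1 / 2) * Complex.Gamma (s / 2)) * I
    · ring
    rw [hI, ← integral_const_mul]
    refine setIntegral_congr_fun measurableSet_Ioi fun t ht => ?_
    have ht' : (0 : ℝ) < t := ht
    have hp := aux_power α T y t hα hT hy ht' s
    have he : Complex.exp (-(t : ℂ) - ((α * T : ℝ) : ℂ) ^ 2 / (4 * (t : ℂ)))
        = ((Real.exp (-t - (α * T) ^ 2 / 4 / t) : ℝ) : ℂ) := by
      push_cast
      congr 1
      rw [div_div]
    simp only [Φ, ← hs]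
    rw [he]
    push_cast at hp ⊢
    linear_combination (1 / 2 * Complex.Gamma (s / 2) *
      Complex.exp (-(t : ℂ) - ((α : ℂ) * T) ^ 2 / 4 / t)) * hp
  simp only [h1]
  have hint : Integrable (Function.uncurry Φ)
      ((volume : Measure ℝ).prod (volume.restrict (Set.Ioi (0 : ℝ)))) := by
    have hΓ : Integrable (fun u : ℝ => Complex.Gamma (((c : ℂ) + (u : ℂ) * Complex.I) / 2)) := by
      simp only [aux_Gamma_half]
      exact (aux_Gamma_int (c / 2) (by positivity)).comp_mul_right' (R := 1 / 2) (by norm_num)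
    have hE := aux_int_exp ((α * T) ^ 2 / 4) (-2 + c / 2) (by positivity)
    have hprod := (hΓ.norm.mul_prod hE).const_mul
      (α * T / 4 * (α ^ 2 * y ^ 2 / 4) ^ (-(c / 2)))
    refine hprod.mono' ?_ ?_
    · have hGm : Measurable (fun u : ℝ => Complex.Gamma (((c : ℂ) + (u : ℂ) * Complex.I) / 2)) := by
        simp only [aux_Gamma_half]
        exact ((aux_Gamma_cont (c / 2) (by positivity)).comp (by fun_prop)).measurable
      have hGm2 : Measurable (fun p : ℝ × ℝ =>
          Complex.Gamma (((c : ℂ) + (p.1 : ℂ) * Complex.I) / 2)) := hGm.comp measurable_fst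
      refine Measurable.aestronglyMeasurable ?_
      unfold Function.uncurry
      simp only [Φ]
      refine Measurable.mul (by fun_prop) (Measurable.mul ?_ hGm2)
      fun_prop
    · have hae : ∀ᵐ p : ℝ × ℝ ∂((volume : Measure ℝ).prod (volume.restrict (Set.Ioi (0 : ℝ)))),
          p.2 ∈ Set.Ioi (0 : ℝ) :=
        Measure.quasiMeasurePreserving_snd.ae (ae_restrict_mem measurableSet_Ioi)
      filter_upwards [hae] with p hp
      have hp' : 0 < p.2 := hp
      simp only [Function.uncurry, Φ, norm_mul]
      rw [Complex.norm_cpow_eq_rpow_re_of_pos (by positivity), Complex.norm_of_nonneg (by positivity),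
        Complex.norm_of_nonneg (by positivity)]
      have hre : (-(((c : ℂ) + (p.1 : ℂ) * Complex.I) / 2)).re = -(c / 2) := by
        simp
      rw [hre, show α ^ 2 * y ^ 2 / (4 * p.2) = (α ^ 2 * y ^ 2 / 4) / p.2 by field_simp,
        Real.div_rpow (by positivity) hp'.le, Real.rpow_neg hp'.le (c / 2), div_inv_eq_mul,
        Real.rpow_add hp']
      apply le_of_eq
      ring
  rw [integral_integral_swap hint]
  have h2 : ∀ t ∈ Set.Ioi (0 : ℝ), (∫ u : ℝ, Φ u t) =
      ((α * T * Real.pi * (Real.exp (-t - (α * T) ^ 2 / 4 / t) * t ^ (-2 : ℝ) *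
        Real.exp (-(α ^ 2 * y ^ 2 / (4 * t)))) : ℝ) : ℂ) := by
    intro t ht
    have ht' : (0 : ℝ) < t := ht
    simp only [Φ]
    rw [integral_const_mul, aux_mellin_half c hc _ (by positivity)]
    push_cast
    ring
  rw [setIntegral_congr_fun measurableSet_Ioi h2, integral_complex_ofReal, integral_const_mul,
    aux_bessel_one α T y hα hT]
  push_cast
  ring

/-- Factorization in the Mellin space for the asymmetric exponential NIG model. -/
theorem mellin_factorization_asymmetric
    (α β δ μ : ℝ) (hα : 0 < α) (hβl : -α < β) (hβu : β < 0) (hδ : 0 < δ)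
    (S r q τ : ℝ) (hS : 0 < S) (hr : 0 ≤ r) (hq : 0 ≤ q) (hτ : 0 < τ)
    (ω : ℝ)
    (hω : ω = -μ + δ * (Real.sqrt (α ^ 2 - (β + 1) ^ 2) - Real.sqrt (α ^ 2 - β ^ 2)))
    (P : ℝ → ℝ) (hPmeas : Measurable P) (hPnn : ∀ y, 0 ≤ P y)
    (hPvanish : ∀ x : ℝ, x ≤ μ * τ → P (S * Real.exp ((r - q + ω) * τ + x)) = 0)
    (Ptilde : Set (ℝ × ℝ)) (hPt : Ptilde ⊆ Set.Ioi 0 ×ˢ Set.Ioi 0)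
    (habs : ∀ s₁ s₂ : ℝ, (s₁, s₂) ∈ Ptilde →
      IntegrableOn (fun x : ℝ =>
        P (S * Real.exp ((r - q + ω) * τ + x)) * (x - μ * τ) ^ (-(s₁ + s₂)))
        (Set.Ioi (μ * τ)))
    (c₁ c₂ : ℝ) (hc : (c₁, c₂) ∈ Ptilde)
    (htriple : Integrable (fun p : ℝ × ℝ × ℝ =>
      (if μ * τ < p.1 then
          P (S * Real.exp ((r - q + ω) * τ + p.1)) * (p.1 - μ * τ) ^ (-(c₁ + c₂))
        else 0) *
        ‖((-β : ℝ) : ℂ) ^ (-((c₂ : ℂ) + (p.2.2 : ℂ) * Complex.I)) *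
            Complex.Gamma (((c₁ : ℂ) + (p.2.1 : ℂ) * Complex.I) / 2) *
            Complex.Gamma ((c₂ : ℂ) + (p.2.2 : ℂ) * Complex.I) *
            besselK (1 - ((c₁ : ℂ) + (p.2.1 : ℂ) * Complex.I) / 2) (α * δ * τ) *
            ((2 * δ * τ / α : ℝ) : ℂ) ^ (((c₁ : ℂ) + (p.2.1 : ℂ) * Complex.I) / 2)‖)) :
    ((Real.exp (-r * τ) *
        ∫ x : ℝ, P (S * Real.exp ((r - q + ω) * τ + x)) * nigDensityA α β δ μ x τ : ℝ) : ℂ)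
      = ((α / (2 * Real.pi) *
            Real.exp ((Real.sqrt (α ^ 2 - β ^ 2) * δ - r) * τ) : ℝ) : ℂ) *
        (((1 / (2 * Real.pi)) ^ 2 : ℝ) : ℂ) *
        ∫ u₁ : ℝ, ∫ u₂ : ℝ,
          ((-β : ℝ) : ℂ) ^ (-((c₂ : ℂ) + (u₂ : ℂ) * Complex.I)) *
            Complex.Gamma (((c₁ : ℂ) + (u₁ : ℂ) * Complex.I) / 2) *
            Complex.Gamma ((c₂ : ℂ) + (u₂ : ℂ) * Complex.I) *
            (∫ x in Set.Ioi (μ * τ), (P (S * Real.exp ((r - q + ω) * τ + x)) : ℂ) *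
              ((x - μ * τ : ℝ) : ℂ) ^
                (-((c₁ : ℂ) + (u₁ : ℂ) * Complex.I) - ((c₂ : ℂ) + (u₂ : ℂ) * Complex.I))) *
            besselK (1 - ((c₁ : ℂ) + (u₁ : ℂ) * Complex.I) / 2) (α * δ * τ) *
            ((2 * δ * τ / α : ℝ) : ℂ) ^ (((c₁ : ℂ) + (u₁ : ℂ) * Complex.I) / 2) := by
  have hcc := hPt hc
  have hc₁ : 0 < c₁ := hcc.1
  have hc₂ : 0 < c₂ := hcc.2
  have hT : 0 < δ * τ := mul_pos hδ hτ
  have hb : 0 < -β := by linarith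
  have eT : α * δ * τ = α * (δ * τ) := by ring
  have eT2 : 2 * δ * τ / α = 2 * (δ * τ) / α := by ring
  simp only [eT, eT2] at htriple ⊢
  set T := δ * τ with hTdef
  set L := μ * τ with hL
  set g : ℝ → ℝ := fun x => P (S * Real.exp ((r - q + ω) * τ + x)) with hg
  have hgm : Measurable g := by
    simp only [hg]
    exact hPmeas.comp (by fun_prop)
  have hgapp : ∀ x, P (S * Real.exp ((r - q + ω) * τ + x)) = g x := fun x => rfl
  have hgnn : ∀ x, 0 ≤ g x := fun x => hPnn _
  simp only [hgapp] at htriple hPvanish ⊢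
  clear_value g
  let A : ℝ → ℂ := fun u => Complex.Gamma (((c₁ : ℂ) + (u : ℂ) * Complex.I) / 2) *
        besselK (1 - ((c₁ : ℂ) + (u : ℂ) * Complex.I) / 2) (α * T) *
        ((2 * T / α : ℝ) : ℂ) ^ (((c₁ : ℂ) + (u : ℂ) * Complex.I) / 2)
  let B : ℝ → ℂ := fun u => ((-β : ℝ) : ℂ) ^ (-((c₂ : ℂ) + (u : ℂ) * Complex.I)) *
        Complex.Gamma ((c₂ : ℂ) + (u : ℂ) * Complex.I)
  let F : ℝ × ℝ × ℝ → ℂ := fun p =>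
    (if L < p.1 then (g p.1 : ℂ) * ((p.1 - L : ℝ) : ℂ) ^
        (-((c₁ : ℂ) + (p.2.1 : ℂ) * Complex.I) - ((c₂ : ℂ) + (p.2.2 : ℂ) * Complex.I)) else 0) *
      (A p.2.1 * B p.2.2)
  have hAm : Measurable A := by
    have hG : Measurable (fun u : ℝ => Complex.Gamma (((c₁ : ℂ) + (u : ℂ) * Complex.I) / 2)) := by
      simp only [aux_Gamma_half]
      exact ((aux_Gamma_cont (c₁ / 2) (by positivity)).comp (by fun_prop)).measurable
    have hK : Measurable (fun u : ℝ =>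
        besselK (1 - ((c₁ : ℂ) + (u : ℂ) * Complex.I) / 2) (α * T)) := by
      unfold besselK
      refine Measurable.mul (by fun_prop) ?_
      refine StronglyMeasurable.measurable ?_
      refine StronglyMeasurable.integral_prod_right (f := fun (u t : ℝ) =>
        Complex.exp (-(t : ℂ) - ((α * T : ℝ) : ℂ) ^ 2 / (4 * (t : ℂ))) *
        (t : ℂ) ^ (-(1 - ((c₁ : ℂ) + (u : ℂ) * Complex.I) / 2) - 1)) ?_
      refine Measurable.stronglyMeasurable ?_
      unfold Function.uncurry
      fun_prop
    refine Measurable.mul (Measurable.mul hG hK) (by fun_prop)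
  have hBm : Measurable B :=
    Measurable.mul (by fun_prop) (aux_Gamma_cont c₂ hc₂).measurable
  have hFm : Measurable F := by
    refine Measurable.mul (Measurable.ite (measurableSet_lt measurable_const measurable_fst) ?_
      measurable_const) ?_
    · have : Measurable fun p : ℝ × ℝ × ℝ => g p.1 := hgm.comp measurable_fst
      fun_prop
    · exact (hAm.comp (measurable_fst.comp measurable_snd)).mul
        (hBm.comp (measurable_snd.comp measurable_snd))
  have hF : Integrable F := by
    refine htriple.mono' hFm.aestronglyMeasurable (Filter.Eventually.of_forall fun p => ?_)
    apply le_of_eq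
    simp only [F]
    rw [norm_mul]
    congr 1
    · split_ifs with h
      · rw [norm_mul, Complex.norm_of_nonneg (hgnn _),
          Complex.norm_cpow_eq_rpow_re_of_pos (by linarith)]
        congr 2
        simp
        ring
      · simp
    · congr 1
      simp only [A, B]
      ring
  have hF' : Integrable F ((volume : Measure ℝ).prod (volume : Measure (ℝ × ℝ))) := hF
  have hswap : ∫ x : ℝ, ∫ w : ℝ × ℝ, F (x, w) = ∫ w : ℝ × ℝ, ∫ x : ℝ, F (x, w) :=
    integral_integral_swap (f := fun x w => F (x, w)) hF'
  have hprod : ∫ w : ℝ × ℝ, ∫ x : ℝ, F (x, w) = ∫ u₁ : ℝ, ∫ u₂ : ℝ, ∫ x : ℝ, F (x, (u₁, u₂)) :=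
    integral_prod (fun w : ℝ × ℝ => ∫ x : ℝ, F (x, w)) hF'.integral_prod_right
  have hR : ∀ u₁ u₂ : ℝ, ∫ x : ℝ, F (x, (u₁, u₂)) =
          ((-β : ℝ) : ℂ) ^ (-((c₂ : ℂ) + (u₂ : ℂ) * Complex.I)) *
            Complex.Gamma (((c₁ : ℂ) + (u₁ : ℂ) * Complex.I) / 2) *
            Complex.Gamma ((c₂ : ℂ) + (u₂ : ℂ) * Complex.I) *
            (∫ x in Set.Ioi L, (g x : ℂ) *
              ((x - L : ℝ) : ℂ) ^
                (-((c₁ : ℂ) + (u₁ : ℂ) * Complex.I) - ((c₂ : ℂ) + (u₂ : ℂ) * Complex.I))) *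
            besselK (1 - ((c₁ : ℂ) + (u₁ : ℂ) * Complex.I) / 2) (α * T) *
            ((2 * T / α : ℝ) : ℂ) ^ (((c₁ : ℂ) + (u₁ : ℂ) * Complex.I) / 2) := by
    intro u₁ u₂
    simp only [F]
    rw [integral_mul_const, ← integral_indicator measurableSet_Ioi]
    simp only [Set.indicator_apply, Set.mem_Ioi, A, B]
    ring
  simp only [← hR]
  rw [← hprod, ← hswap]
  have hX : ∀ x : ℝ, ((g x * nigDensityA α β δ μ x τ : ℝ) : ℂ) =
      ((α / (2 * Real.pi) * Real.exp (Real.sqrt (α ^ 2 - β ^ 2) * T) *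
        (1 / (2 * Real.pi)) ^ 2 : ℝ) : ℂ) * ∫ w : ℝ × ℝ, F (x, w) := by
    intro x
    by_cases hx : L < x
    · have hy : 0 < x - L := by linarith
      have hw : ∀ w : ℝ × ℝ, F (x, w) = (g x : ℂ) *
          ((((x - L : ℝ) : ℂ) ^ (-((c₁ : ℂ) + (w.1 : ℂ) * Complex.I)) * A w.1) *
          (((x - L : ℝ) : ℂ) ^ (-((c₂ : ℂ) + (w.2 : ℂ) * Complex.I)) * B w.2)) := by
        intro w
        simp only [F, if_pos hx]
        rw [sub_eq_add_neg (-((c₁ : ℂ) + (w.1 : ℂ) * Complex.I)),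
          Complex.cpow_add _ _ (by exact_mod_cast hy.ne')]
        ring
      simp only [hw]
      rw [integral_const_mul]
      have hm : (∫ w : ℝ × ℝ,
          ((((x - L : ℝ) : ℂ) ^ (-((c₁ : ℂ) + (w.1 : ℂ) * Complex.I)) * A w.1) *
          (((x - L : ℝ) : ℂ) ^ (-((c₂ : ℂ) + (w.2 : ℂ) * Complex.I)) * B w.2)))
          = (4 * Real.pi * T * ((besselKr 1 (α * Real.sqrt (T ^ 2 + (x - L) ^ 2)) /
              Real.sqrt (T ^ 2 + (x - L) ^ 2) : ℝ) : ℂ)) *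
            (2 * Real.pi * (Real.exp (-(-β * (x - L))) : ℂ)) := by
        rw [← aux_fst α T (x - L) c₁ hα hT hy hc₁, ← aux_mellin_scaled c₂ hc₂ (-β) (x - L) hb hy]
        exact integral_prod_mul
          (fun u : ℝ => ((x - L : ℝ) : ℂ) ^ (-((c₁ : ℂ) + (u : ℂ) * Complex.I)) * A u)
          (fun u : ℝ => ((x - L : ℝ) : ℂ) ^ (-((c₂ : ℂ) + (u : ℂ) * Complex.I)) * B u)
      rw [hm]
      unfold nigDensityA
      rw [← hL, ← hTdef, mul_assoc (Real.sqrt (α ^ 2 - β ^ 2)) δ τ, ← hTdef, mul_assoc α δ τ,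
        ← hTdef, Real.exp_add, show -(-β * (x - L)) = β * (x - L) by ring]
      generalize besselKr 1 (α * Real.sqrt (T ^ 2 + (x - L) ^ 2)) = k
      norm_cast
      have := Real.pi_pos
      have hk : 0 < Real.sqrt (T ^ 2 + (x - L) ^ 2) := Real.sqrt_pos.mpr (by positivity)
      generalize Real.sqrt (T ^ 2 + (x - L) ^ 2) = κ at hk
      generalize Real.exp (Real.sqrt (α ^ 2 - β ^ 2) * T) = E1
      generalize Real.exp (β * (x - L)) = E2
      field_simp
      ring
    · have h0 : g x = 0 := hPvanish x (not_lt.mp hx)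
      simp [F, hx, h0]
  push_cast [← integral_complex_ofReal]
  have hX' : ∀ x : ℝ, (g x : ℂ) * (nigDensityA α β δ μ x τ : ℂ) =
      ((α / (2 * Real.pi) * Real.exp (Real.sqrt (α ^ 2 - β ^ 2) * T) *
        (1 / (2 * Real.pi)) ^ 2 : ℝ) : ℂ) * ∫ w : ℝ × ℝ, F (x, w) := by
    intro x
    rw [← hX x]; push_cast; rfl
  simp only [hX']
  rw [integral_const_mul]
  have he : Complex.exp (((Real.sqrt (α ^ 2 - β ^ 2) : ℂ) * δ - r) * τ) =
      Complex.exp (-r * τ) * Complex.exp ((Real.sqrt (α ^ 2 - β ^ 2) : ℂ) * (T : ℂ)) := by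
    rw [← Complex.exp_add, hTdef]
    congr 1
    push_cast
    ring
  rw [he]
  push_cast
  ring
end

section
/- Cash-or-nothing call (asymmetric model): let α > 0, β ∈ (−α, α−1) with β ≠ 0, δ > 0, μ ∈ ℝ, γ := √(α²−β²), and assume |k₀| < δτ. Then the price C_{c/n} := e^{−rτ} ∫_ℝ 1_{{x > −k}} f(x,τ) dx of the cash-or-nothing call (payoff 1_{{S_T > K}}) equals the convergent iterated double series C_{c/n} = (α e^{(γδ−r)τ}/√π) · Σ_{n₁=0}^∞ Σ_{n₂=0}^∞ [(−n₁+1)_{n₂} · k₀^{n₁} β^{n₂} / (n₁! n₂! Γ(1 + (n₂−n₁)/2))] · K_{(n₁−n₂+1)/2}(αδτ) · (δτ/(2α))^{(n₂−n₁+1)/2}, where (a)_{n} := ∏_{j=0}^{n−1}(a+j) is the rising factorial. -/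
open MeasureTheory

/-- Rising factorial (Pochhammer symbol) `(a)_n = ∏_{j=0}^{n-1} (a + j)`. -/
noncomputable def risingFactorial (a : ℝ) (n : ℕ) : ℝ :=
  ∏ j ∈ Finset.range n, (a + (j : ℝ))

/-- General term of the cash-or-nothing call series in the asymmetric model. -/
noncomputable def cnTermA (α β δ τ k₀ : ℝ) (n₁ n₂ : ℕ) : ℝ :=
  risingFactorial (-(n₁ : ℝ) + 1) n₂ * k₀ ^ n₁ * β ^ n₂ /
      ((n₁.factorial : ℝ) * (n₂.factorial : ℝ)) *
    (Real.Gamma (1 + ((n₂ : ℝ) - (n₁ : ℝ)) / 2))⁻¹ *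
    besselKr (((n₁ : ℝ) - (n₂ : ℝ) + 1) / 2) (α * δ * τ) *
    (δ * τ / (2 * α)) ^ (((n₂ : ℝ) - (n₁ : ℝ) + 1) / 2)


/-- Moment integral `∫₀^∞ exp(-t - c T²/t) t^s dt`. -/
noncomputable def nigJ (c T s : ℝ) : ℝ :=
  ∫ t in Set.Ioi (0 : ℝ), Real.exp (-t - c * T ^ 2 / t) * t ^ s

/-- The kernel of `nigH`. -/
noncomputable def nigKer (c T y t : ℝ) : ℝ :=
  Real.exp (-t - c * (T ^ 2 + y ^ 2) / t) * t ^ (-2 : ℝ)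

/-- Unnormalised symmetric density. -/
noncomputable def nigH (c T y : ℝ) : ℝ :=
  ∫ t in Set.Ioi (0 : ℝ), nigKer c T y t

lemma nig_int_base {A : ℝ} (hA : 0 < A) :
    IntegrableOn (fun t : ℝ => Real.exp (-(A / t)) * t ^ (-2 : ℝ)) (Set.Ioi 0) := by
  set m : ℝ := min 1 (A ^ 2 / 2) with hm
  have hmpos : 0 < m := by positivity
  have hintg : IntegrableOn (fun t : ℝ => m⁻¹ * (1 + t ^ 2)⁻¹) (Set.Ioi 0) :=
    (integrable_inv_one_add_sq.const_mul _).integrableOn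
  refine Integrable.mono' hintg (by fun_prop) ?_
  filter_upwards [ae_restrict_mem measurableSet_Ioi] with t ht
  have ht : 0 < t := ht
  rw [Real.norm_of_nonneg (by positivity), Real.exp_neg, Real.rpow_neg ht.le, Real.rpow_two,
    ← mul_inv, ← mul_inv]
  refine inv_anti₀ (by positivity) ?_
  have h1 := Real.quadratic_le_exp_of_nonneg (x := A / t) (by positivity)
  have h2 : (1 + A / t + (A / t) ^ 2 / 2) * t ^ 2 = t ^ 2 + A * t + A ^ 2 / 2 := by
    field_simp
  have h3 : (1 + A / t + (A / t) ^ 2 / 2) * t ^ 2 ≤ Real.exp (A / t) * t ^ 2 := by gcongr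
  have h4 : m ≤ 1 := min_le_left _ _
  have h5 : m ≤ A ^ 2 / 2 := min_le_right _ _
  have h6 : m * t ^ 2 ≤ t ^ 2 := by nlinarith [sq_nonneg t]
  have h7 : 0 < A * t := by positivity
  nlinarith

lemma nig_int_exp {A : ℝ} (hA : 0 < A) :
    IntegrableOn (fun t : ℝ => Real.exp (-t - A / t) * t ^ (-2 : ℝ)) (Set.Ioi 0) := by
  refine Integrable.mono' (nig_int_base hA) (by fun_prop) ?_
  filter_upwards [ae_restrict_mem measurableSet_Ioi] with t ht
  have ht : 0 < t := ht
  rw [Real.norm_of_nonneg (by positivity)]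
  gcongr
  linarith

lemma nigKer_meas (c T : ℝ) : Measurable (Function.uncurry (nigKer c T)) := by
  unfold nigKer Function.uncurry
  fun_prop

lemma nigKer_int {c T : ℝ} (hc : 0 < c) (hT : 0 < T) (y : ℝ) :
    IntegrableOn (nigKer c T y) (Set.Ioi 0) := by
  have := nig_int_exp (A := c * (T ^ 2 + y ^ 2)) (by positivity)
  exact this

lemma nigH_meas (c T : ℝ) : StronglyMeasurable (nigH c T) := by
  unfold nigH
  exact (nigKer_meas c T).stronglyMeasurable.integral_prod_right

lemma nigKer_nonneg (c T y : ℝ) {t : ℝ} (ht : 0 < t) : 0 ≤ nigKer c T y t := by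
  unfold nigKer; positivity

lemma nigH_nonneg (c T y : ℝ) : 0 ≤ nigH c T y :=
  setIntegral_nonneg measurableSet_Ioi fun _ ht => nigKer_nonneg c T y ht

lemma nigH_le {α T : ℝ} (hα : 0 < α) (hT : 0 < T) :
    ∃ C, 0 ≤ C ∧ ∀ y, nigH (α ^ 2 / 4) T y ≤ C * Real.exp (-α * |y|) := by
  refine ⟨∫ t in Set.Ioi (0 : ℝ), Real.exp (-((α ^ 2 / 4 * T ^ 2) / t)) * t ^ (-2 : ℝ), ?_, ?_⟩
  · refine setIntegral_nonneg measurableSet_Ioi fun t ht => ?_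
    have ht : 0 < t := ht
    positivity
  · intro y
    rw [← integral_mul_const]
    refine setIntegral_mono_on (nigKer_int (by positivity) hT y)
      ((nig_int_base (by positivity)).mul_const _) measurableSet_Ioi fun t ht => ?_
    have ht : 0 < t := ht
    unfold nigKer
    rw [mul_right_comm, ← Real.exp_add]
    gcongr
    have e : t + α ^ 2 / 4 * y ^ 2 / t - α * |y| = (t - α / 2 * |y|) ^ 2 / t := by
      rw [← sq_abs y]; field_simp; ring
    have e2 : 0 ≤ (t - α / 2 * |y|) ^ 2 / t := by positivity
    have e3 : α ^ 2 / 4 * (T ^ 2 + y ^ 2) / t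
      = α ^ 2 / 4 * T ^ 2 / t + α ^ 2 / 4 * y ^ 2 / t := by ring
    rw [e3]; linarith

lemma nig_g_int {α T β : ℝ} (hα : 0 < α) (hT : 0 < T) (hβ : |β| < α) (a : ℝ) :
    IntegrableOn (fun y => Real.exp (β * y) * nigH (α ^ 2 / 4) T y) (Set.Ioi a) := by
  obtain ⟨C, hC, hle⟩ := nigH_le hα hT
  have hintg := (exp_neg_integrableOn_Ioi a (b := α - |β|) (by linarith)).const_mul C
  refine Integrable.mono' hintg ?_ ?_
  · exact ((by fun_prop : Measurable fun y : ℝ => Real.exp (β * y)).stronglyMeasurable.mul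
      (nigH_meas _ _)).aestronglyMeasurable
  · refine Filter.Eventually.of_forall fun y => ?_
    rw [Real.norm_of_nonneg (mul_nonneg (Real.exp_pos _).le (nigH_nonneg _ _ _))]
    calc _ ≤ Real.exp (β * y) * (C * Real.exp (-α * |y|)) := by gcongr; exact hle y
      _ = C * Real.exp (β * y + -α * |y|) := by rw [Real.exp_add]; ring
      _ ≤ _ := by
        gcongr
        have h1 : β * y ≤ |β| * |y| := by rw [← abs_mul]; exact le_abs_self _
        have h2 := le_abs_self y
        nlinarith

lemma nig_hasSum_exp (x : ℝ) : HasSum (fun n : ℕ => x ^ n / (n.factorial : ℝ)) (Real.exp x) := by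
  rw [Real.exp_eq_exp_ℝ]
  exact NormedSpace.expSeries_div_hasSum_exp x

lemma nig_pow_le (b y : ℝ) (hb : 0 ≤ b) (hy : 0 ≤ y) (n : ℕ) :
    (b * y) ^ n / (n.factorial : ℝ) ≤ Real.exp (b * y) :=
  Real.pow_div_factorial_le_exp _ (by positivity) n

/-- Term-by-term integration on the half line. -/
lemma nig_halfline {α T β : ℝ} (hα : 0 < α) (hT : 0 < T) (hβ : |β| < α) :
    HasSum (fun n : ℕ => β ^ n / (n.factorial : ℝ) *
        ∫ y in Set.Ioi (0 : ℝ), y ^ n * nigH (α ^ 2 / 4) T y)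
      (∫ y in Set.Ioi (0 : ℝ), Real.exp (β * y) * nigH (α ^ 2 / 4) T y) := by
  have key := hasSum_integral_of_dominated_convergence
    (μ := volume.restrict (Set.Ioi (0 : ℝ)))
    (F := fun (n : ℕ) y => (β * y) ^ n / (n.factorial : ℝ) * nigH (α ^ 2 / 4) T y)
    (f := fun y => Real.exp (β * y) * nigH (α ^ 2 / 4) T y)
    (fun (n : ℕ) y => (|β| * y) ^ n / (n.factorial : ℝ) * nigH (α ^ 2 / 4) T y)
    ?_ ?_ ?_ ?_ ?_
  · convert! key using 2 with n
    rw [← integral_const_mul]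
    congr 1; ext y; rw [mul_pow]; ring
  · intro n
    exact ((by fun_prop : Measurable fun y : ℝ => (β * y) ^ n / (n.factorial : ℝ)).stronglyMeasurable.mul
      (nigH_meas _ _)).aestronglyMeasurable
  · intro n
    filter_upwards [ae_restrict_mem measurableSet_Ioi] with y hy
    have hy : 0 < y := hy
    rw [norm_mul, norm_div, norm_pow, norm_mul, Real.norm_of_nonneg (nigH_nonneg _ _ _)]
    simp [abs_of_pos hy]
  · exact Filter.Eventually.of_forall fun y => ((nig_hasSum_exp _).mul_right _).summable
  · have := nig_g_int hα hT (β := |β|) (by simpa using hβ) 0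
    refine this.congr (Filter.Eventually.of_forall fun y => ?_)
    exact (((nig_hasSum_exp _).mul_right _).tsum_eq).symm
  · exact Filter.Eventually.of_forall fun y => (nig_hasSum_exp _).mul_right _

lemma nig_moment_int {α T : ℝ} (hα : 0 < α) (hT : 0 < T) (n : ℕ) :
    IntegrableOn (fun y => y ^ n * nigH (α ^ 2 / 4) T y) (Set.Ioi 0) := by
  have h := (nig_g_int hα hT (β := α / 2) (by rw [abs_of_pos] <;> linarith) 0).const_mul
    ((n.factorial : ℝ) / (α / 2) ^ n)
  refine Integrable.mono' h ?_ ?_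
  · exact ((by fun_prop : Measurable fun y : ℝ => y ^ n).stronglyMeasurable.mul
      (nigH_meas _ _)).aestronglyMeasurable
  · filter_upwards [ae_restrict_mem measurableSet_Ioi] with y hy
    have hy : 0 < y := hy
    rw [Real.norm_of_nonneg (mul_nonneg (by positivity) (nigH_nonneg _ _ _)), ← mul_assoc]
    refine mul_le_mul_of_nonneg_right ?_ (nigH_nonneg _ _ _)
    have := nig_pow_le (α / 2) y (by positivity) hy.le n
    calc y ^ n = (n.factorial : ℝ) / (α / 2) ^ n * ((α / 2 * y) ^ n / (n.factorial : ℝ)) := by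
          rw [mul_pow]; field_simp
      _ ≤ _ := by gcongr

lemma nig_moment {α T : ℝ} (hα : 0 < α) (hT : 0 < T) (n : ℕ) :
    ∫ y in Set.Ioi (0 : ℝ), y ^ n * nigH (α ^ 2 / 4) T y
      = (α ^ 2 / 4) ^ (-((n : ℝ) + 1) / 2) * (1 / 2) * Real.Gamma (((n : ℝ) + 1) / 2)
        * nigJ (α ^ 2 / 4) T (((n : ℝ) - 3) / 2) := by
  set c := α ^ 2 / 4 with hc
  have hcpos : 0 < c := by positivity
  have e1 : ∀ y, y ^ n * nigH c T y = ∫ t in Set.Ioi (0 : ℝ), y ^ n * nigKer c T y t := by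
    intro y; rw [integral_const_mul]; rfl
  simp_rw [e1]
  rw [integral_integral_swap]
  · unfold nigJ
    rw [← integral_const_mul]
    refine setIntegral_congr_fun measurableSet_Ioi fun t ht => ?_
    have ht : 0 < t := ht
    have e2 : ∀ y ∈ Set.Ioi (0 : ℝ), y ^ n * nigKer c T y t
        = (Real.exp (-t - c * T ^ 2 / t) * t ^ (-2 : ℝ)) *
          (y ^ (n : ℝ) * Real.exp (-(c / t) * y ^ (2 : ℝ))) := by
      intro y hy
      unfold nigKer
      rw [Real.rpow_natCast, Real.rpow_two]
      have : -t - c * (T ^ 2 + y ^ 2) / t = (-t - c * T ^ 2 / t) + (-(c / t) * y ^ 2) := by ring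
      rw [this, Real.exp_add]; ring
    beta_reduce
    rw [setIntegral_congr_fun measurableSet_Ioi e2, integral_const_mul,
      integral_rpow_mul_exp_neg_mul_rpow (by norm_num)
        (by have : (0 : ℝ) ≤ n := by positivity
            linarith) (by positivity),
      Real.div_rpow hcpos.le ht.le]
    have e3 : t ^ (-2 : ℝ) / t ^ (-((n : ℝ) + 1) / 2) = t ^ (((n : ℝ) - 3) / 2) := by
      rw [← Real.rpow_sub ht]; congr 1; ring
    rw [← e3]; ring
  · have hm : Measurable (Function.uncurry fun y t => y ^ n * nigKer c T y t) := by
      have := nigKer_meas c T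
      have h2 : Measurable fun p : ℝ × ℝ => p.1 ^ n := by fun_prop
      exact h2.mul this
    rw [integrable_prod_iff hm.aestronglyMeasurable]
    refine ⟨Filter.Eventually.of_forall fun y => by
      simpa [Function.uncurry] using (nigKer_int hcpos hT y).const_mul (y ^ n), ?_⟩
    refine (nig_moment_int hα hT n).congr ?_
    filter_upwards [ae_restrict_mem measurableSet_Ioi] with y hy
    have hy : 0 < y := hy
    rw [← hc, e1]
    refine setIntegral_congr_fun measurableSet_Ioi fun t ht => ?_
    exact (Real.norm_of_nonneg (mul_nonneg (by positivity) (nigKer_nonneg _ _ _ ht))).symm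

/-- Power series of `nigH`, with a sign parameter. -/
lemma nigH_series {c T y s : ℝ} (hc : 0 < c) (hs : s = 1 ∨ s = -1) (hy : |y| < T) :
    HasSum (fun j : ℕ => (s * c) ^ j / (j.factorial : ℝ) * y ^ (2 * j)
        * nigJ c T (-(j : ℝ) - 2))
      (∫ t in Set.Ioi (0 : ℝ), Real.exp (-t - c * (T ^ 2 - s * y ^ 2) / t) * t ^ (-2 : ℝ)) := by
  have hs1 : |s| = 1 := by rcases hs with rfl | rfl <;> simp
  have hpos : 0 < T ^ 2 - y ^ 2 := by
    rw [← sq_abs y]; nlinarith [abs_nonneg y]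
  have key := hasSum_integral_of_dominated_convergence
    (μ := volume.restrict (Set.Ioi (0 : ℝ)))
    (F := fun (j : ℕ) t => (s * c * y ^ 2 / t) ^ j / (j.factorial : ℝ) *
      (Real.exp (-t - c * T ^ 2 / t) * t ^ (-2 : ℝ)))
    (f := fun t => Real.exp (-t - c * (T ^ 2 - s * y ^ 2) / t) * t ^ (-2 : ℝ))
    (fun (j : ℕ) t => (c * y ^ 2 / t) ^ j / (j.factorial : ℝ) *
      (Real.exp (-t - c * T ^ 2 / t) * t ^ (-2 : ℝ)))
    ?_ ?_ ?_ ?_ ?_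
  · convert! key using 2 with j
    unfold nigJ
    rw [← integral_const_mul]
    refine setIntegral_congr_fun measurableSet_Ioi fun t ht => ?_
    have ht : 0 < t := ht
    beta_reduce
    rw [show -(j : ℝ) - 2 = -2 - (j : ℝ) by ring, Real.rpow_sub ht, Real.rpow_natCast,
      div_pow, mul_pow (s * c), ← pow_mul]
    ring
  · intro j
    fun_prop
  · intro j
    filter_upwards [ae_restrict_mem measurableSet_Ioi] with t ht
    have ht : 0 < t := ht
    rw [norm_mul, Real.norm_of_nonneg (by positivity : 0 ≤ Real.exp (-t - c * T ^ 2 / t) * t ^ (-2 : ℝ)),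
      norm_div, norm_pow, norm_div, norm_mul, norm_mul, Real.norm_eq_abs s, hs1]
    simp [abs_of_pos ht, abs_of_pos hc]
  · exact Filter.Eventually.of_forall fun y => ((nig_hasSum_exp _).mul_right _).summable
  · refine (nig_int_exp (A := c * (T ^ 2 - y ^ 2)) (by positivity)).congr
      (Filter.Eventually.of_forall fun t => ?_)
    beta_reduce
    rw [((nig_hasSum_exp _).mul_right _).tsum_eq, ← mul_assoc, ← Real.exp_add]
    congr 2; ring
  · refine Filter.Eventually.of_forall fun t => ?_
    have := (nig_hasSum_exp (s * c * y ^ 2 / t)).mul_right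
      (Real.exp (-t - c * T ^ 2 / t) * t ^ (-2 : ℝ))
    convert! this using 1
    rw [← mul_assoc, ← Real.exp_add]
    congr 2; ring

/-- Taylor coefficients of `nigH` at the origin. -/
noncomputable def nigA (c T : ℝ) (i : ℕ) : ℝ :=
  if Even i then (-c) ^ (i / 2) / ((i / 2).factorial : ℝ) * nigJ c T (-((i / 2 : ℕ) : ℝ) - 2) else 0

lemma nigJ_nonneg (c T s : ℝ) : 0 ≤ nigJ c T s := by
  refine setIntegral_nonneg measurableSet_Ioi fun t ht => ?_
  have ht : 0 < t := ht
  positivity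

lemma nigA_even (c T : ℝ) (j : ℕ) :
    nigA c T (2 * j) = (-c) ^ j / (j.factorial : ℝ) * nigJ c T (-(j : ℝ) - 2) := by
  simp [nigA]

lemma nigA_odd (c T : ℝ) (j : ℕ) : nigA c T (2 * j + 1) = 0 := by
  simp [nigA]

lemma nigA_hasSum {c T y : ℝ} (hc : 0 < c) (hy : |y| < T) :
    HasSum (fun i => nigA c T i * y ^ i) (nigH c T y) := by
  have h1 := nigH_series (T := T) (y := y) (s := -1) hc (Or.inr rfl) hy
  have h2 : HasSum (fun j => nigA c T (2 * j) * y ^ (2 * j)) (nigH c T y) := by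
    convert! h1 using 1
    · ext j; rw [nigA_even]; ring
    · unfold nigH nigKer; congr 1; ext t; congr 3; ring
  have h3 : HasSum (fun j => nigA c T (2 * j + 1) * y ^ (2 * j + 1)) 0 := by
    simp only [nigA_odd, zero_mul]; exact hasSum_zero
  have h4 := HasSum.even_add_odd (f := fun i => nigA c T i * y ^ i) h2 h3
  rwa [add_zero] at h4

lemma nigA_norm {c T y : ℝ} (hc : 0 < c) (hy : |y| < T) :
    Summable (fun i => ‖nigA c T i * y ^ i‖) := by
  have h1 := nigH_series (T := T) (y := y) (s := 1) hc (Or.inl rfl) hy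
  have h2 : Summable (fun j => ‖nigA c T (2 * j) * y ^ (2 * j)‖) := by
    convert! h1.summable using 1
    ext j
    rw [nigA_even, norm_mul, norm_mul, norm_div, norm_pow, norm_pow, norm_neg,
      Real.norm_of_nonneg (nigJ_nonneg _ _ _), Real.norm_of_nonneg hc.le, pow_mul ‖y‖,
      Real.norm_eq_abs y, sq_abs, ← pow_mul]
    simp; ring
  have h3 : HasSum (fun j => ‖nigA c T (2 * j + 1) * y ^ (2 * j + 1)‖) 0 := by
    simp only [nigA_odd, zero_mul, norm_zero]; exact hasSum_zero
  exact (HasSum.even_add_odd (f := fun i => ‖nigA c T i * y ^ i‖) h2.hasSum h3).summable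

/-- Taylor coefficients of `exp (β y) * nigH y`. -/
noncomputable def nigC (c T β : ℝ) (m : ℕ) : ℝ :=
  ∑ n ∈ Finset.range (m + 1), β ^ n / (n.factorial : ℝ) * nigA c T (m - n)

lemma nigC_aux (c T β y : ℝ) (m : ℕ) :
    ∑ n ∈ Finset.range (m + 1), ((β * y) ^ n / (n.factorial : ℝ)) * (nigA c T (m - n) * y ^ (m - n))
      = nigC c T β m * y ^ m := by
  unfold nigC
  rw [Finset.sum_mul]
  refine Finset.sum_congr rfl fun n hn => ?_
  have hn : n ≤ m := by simpa [Nat.lt_succ_iff] using hn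
  have : y ^ m = y ^ n * y ^ (m - n) := by rw [← pow_add, Nat.add_sub_cancel' hn]
  rw [this, mul_pow]; ring

lemma nig_exp_norm (x : ℝ) : Summable (fun n : ℕ => ‖x ^ n / (n.factorial : ℝ)‖) := by
  have := (nig_hasSum_exp |x|).summable
  convert! this using 2 with n
  simp

lemma nigC_hasSum {c T y : ℝ} (β : ℝ) (hc : 0 < c) (hy : |y| < T) :
    HasSum (fun m => nigC c T β m * y ^ m) (Real.exp (β * y) * nigH c T y) := by
  have := hasSum_sum_range_mul_of_summable_norm (nig_exp_norm (β * y)) (nigA_norm hc hy)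
  rw [(nig_hasSum_exp _).tsum_eq, (nigA_hasSum hc hy).tsum_eq] at this
  simpa only [nigC_aux] using this

lemma nigC_norm {c T y : ℝ} (β : ℝ) (hc : 0 < c) (hy : |y| < T) :
    Summable (fun m => ‖nigC c T β m * y ^ m‖) := by
  have := summable_norm_sum_mul_range_of_summable_norm (nig_exp_norm (β * y)) (nigA_norm hc hy)
  simpa only [nigC_aux] using this

lemma nigC_integral {c T k : ℝ} (β : ℝ) (hc : 0 < c) (hk : |k| < T) :
    HasSum (fun m : ℕ => nigC c T β m * ((-1) ^ m * k ^ (m + 1) / ((m : ℝ) + 1)))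
      (∫ y in (-k)..0, Real.exp (β * y) * nigH c T y) := by
  have hab : ∀ y ∈ Set.uIoc (-k) 0, |y| ≤ |k| := by
    intro y hy
    rcases Set.mem_uIoc.1 hy with h | h
    · rw [abs_of_nonpos h.2]; exact (by linarith : -y ≤ k).trans (le_abs_self k)
    · rw [abs_of_pos h.1]; exact h.2.trans (neg_le_abs k)
  have key := intervalIntegral.hasSum_integral_of_dominated_convergence
    (μ := volume) (a := -k) (b := 0)
    (F := fun (m : ℕ) y => nigC c T β m * y ^ m)
    (f := fun y => Real.exp (β * y) * nigH c T y)
    (fun (m : ℕ) _ => ‖nigC c T β m * k ^ m‖) ?_ ?_ ?_ ?_ ?_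
  · convert! key using 2 with m
    rw [intervalIntegral.integral_const_mul, integral_pow, neg_pow k]
    simp only [ne_eq, Nat.add_eq_zero_iff, one_ne_zero, and_false, not_false_eq_true, zero_pow,
      pow_succ (-1 : ℝ)]
    ring
  · intro m; fun_prop
  · intro m
    refine Filter.Eventually.of_forall fun y hy => ?_
    rw [norm_mul, norm_mul, norm_pow, norm_pow]
    gcongr
    exact hab y hy
  · exact Filter.Eventually.of_forall fun y hy => nigC_norm β hc hk
  · exact intervalIntegrable_const
  · exact Filter.Eventually.of_forall fun y hy => nigC_hasSum β hc ((hab y hy).trans_lt hk)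

lemma nig_rising_one (n : ℕ) : risingFactorial 1 n = n.factorial := by
  unfold risingFactorial
  induction n with
  | zero => simp
  | succ n ih => rw [Finset.prod_range_succ, ih, Nat.factorial_succ]; push_cast; ring

lemma nig_rising_neg (i n : ℕ) :
    risingFactorial (-((n + i : ℕ) : ℝ)) n * (i.factorial : ℝ) = (-1) ^ n * ((n + i).factorial : ℝ) := by
  unfold risingFactorial
  induction n generalizing i with
  | zero => simp
  | succ n ih =>
    have := ih (i + 1)
    rw [Finset.prod_range_succ, show n + 1 + i = n + (i + 1) by ring, pow_succ,
      mul_right_comm _ (-1 : ℝ), ← this, Nat.factorial_succ]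
    push_cast; ring

lemma nig_rising_zero (m n : ℕ) (h : m < n) : risingFactorial (-(m : ℝ)) n = 0 := by
  unfold risingFactorial
  exact Finset.prod_eq_zero (Finset.mem_range.2 h) (by ring)

lemma nig_gamma_half (j : ℕ) :
    (Real.Gamma (1 / 2 - (j : ℝ)))⁻¹
      = (-1) ^ j * ((2 * j).factorial : ℝ) / (4 ^ j * (j.factorial : ℝ) * Real.sqrt Real.pi) := by
  induction j with
  | zero => simp [Real.Gamma_one_half_eq, -one_div]; simp
  | succ j ih =>
    have hne : (1 / 2 - ((j + 1 : ℕ) : ℝ)) ≠ 0 := by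
      push_cast
      have : (0 : ℝ) ≤ j := by positivity
      linarith
    have h := Real.Gamma_add_one hne
    rw [show (1 / 2 - ((j + 1 : ℕ) : ℝ)) + 1 = 1 / 2 - (j : ℝ) by push_cast; ring] at h
    rw [h, mul_inv] at ih
    have h2 : (Real.Gamma (1 / 2 - ((j + 1 : ℕ) : ℝ)))⁻¹ = (1 / 2 - ((j + 1 : ℕ) : ℝ)) *
        ((1 / 2 - ((j + 1 : ℕ) : ℝ))⁻¹ * (Real.Gamma (1 / 2 - ((j + 1 : ℕ) : ℝ)))⁻¹) := by
      rw [mul_inv_cancel_left₀ hne]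
    rw [h2, ih, show 2 * (j + 1) = 2 * j + 1 + 1 by ring, Nat.factorial_succ, Nat.factorial_succ,
      Nat.factorial_succ]
    have : Real.sqrt Real.pi ≠ 0 := by positivity
    push_cast
    field_simp
    ring

lemma nig_bessel (α T ν : ℝ) :
    besselKr ν (α * T) = 1 / 2 * (α * T / 2) ^ ν * nigJ (α ^ 2 / 4) T (-ν - 1) := by
  unfold besselKr nigJ
  congr 3
  ext t
  congr 3
  rw [mul_pow]
  field_simp

lemma nig_cn_zero {α β δ τ : ℝ} (k₀ : ℝ) (hα : 0 < α) (hT : 0 < δ * τ) (n : ℕ) :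
    cnTermA α β δ τ k₀ 0 n = α * (δ * τ) / (4 * Real.sqrt Real.pi) *
      (β ^ n / (n.factorial : ℝ) *
        ∫ y in Set.Ioi (0 : ℝ), y ^ n * nigH (α ^ 2 / 4) (δ * τ) y) := by
  rw [nig_moment hα hT]
  unfold cnTermA
  rw [mul_assoc α, nig_bessel]
  set T := δ * τ
  have hdup := Real.Gamma_mul_Gamma_add_half (((n : ℝ) + 1) / 2)
  rw [show ((n : ℝ) + 1) / 2 + 1 / 2 = 1 + ((n : ℝ) - (0 : ℕ)) / 2 by push_cast; ring,
    show 2 * (((n : ℝ) + 1) / 2) = (n : ℝ) + 1 by ring, Real.Gamma_nat_eq_factorial,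
    show 1 - ((n : ℝ) + 1) = -(n : ℝ) by ring, Real.rpow_neg (by norm_num), Real.rpow_natCast] at hdup
  have hG : Real.Gamma (1 + ((n : ℝ) - (0 : ℕ)) / 2) ≠ 0 := by
    refine (Real.Gamma_pos_of_pos ?_).ne'
    have : (0 : ℝ) ≤ n := by positivity
    push_cast; linarith
  have hG2 : Real.Gamma (((n : ℝ) + 1) / 2)
      = (n.factorial : ℝ) * (2 ^ n)⁻¹ * Real.sqrt Real.pi
        * (Real.Gamma (1 + ((n : ℝ) - (0 : ℕ)) / 2))⁻¹ := by
    rw [← hdup, mul_assoc, mul_inv_cancel₀ hG, mul_one]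
  rw [hG2, show -((0 : ℕ) : ℝ) + 1 = 1 by simp, nig_rising_one,
    show -((((0 : ℕ) : ℝ) - (n : ℝ) + 1) / 2) - 1 = ((n : ℝ) - 3) / 2 by push_cast; ring]
  have p1 : (α * T / 2) ^ ((((0 : ℕ) : ℝ) - (n : ℝ) + 1) / 2)
      * (T / (2 * α)) ^ (((n : ℝ) - ((0 : ℕ) : ℝ) + 1) / 2) = T / 2 * (α ^ n)⁻¹ := by
    rw [show α * T / 2 = (T / 2) * α by ring, show T / (2 * α) = (T / 2) / α by field_simp,
      Real.mul_rpow (by positivity) hα.le, Real.div_rpow (by positivity) hα.le,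
      mul_div_assoc', mul_right_comm, ← Real.rpow_add (by positivity), mul_div_assoc,
      ← Real.rpow_sub hα, ← Real.rpow_natCast, ← Real.rpow_neg hα.le]
    rw [show (((0 : ℕ) : ℝ) - (n : ℝ) + 1) / 2 + ((n : ℝ) - ((0 : ℕ) : ℝ) + 1) / 2 = 1 by
      push_cast; ring, Real.rpow_one]
    congr 2; push_cast; ring
  have p2 : (α ^ 2 / 4) ^ (-((n : ℝ) + 1) / 2) = 2 ^ (n + 1) / α ^ (n + 1) := by
    rw [show α ^ 2 / 4 = (α / 2) ^ (2 : ℝ) by rw [Real.rpow_two]; ring,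
      ← Real.rpow_mul (by positivity),
      show 2 * (-((n : ℝ) + 1) / 2) = -((n + 1 : ℕ) : ℝ) by push_cast; ring,
      Real.rpow_neg (by positivity), Real.rpow_natCast, div_pow, inv_div]
  have hs : Real.sqrt Real.pi ≠ 0 := by positivity
  have hf : (n.factorial : ℝ) ≠ 0 := by positivity
  rw [p2]
  generalize nigJ (α ^ 2 / 4) T (((n : ℝ) - 3) / 2) = J
  generalize (Real.Gamma (1 + ((n : ℝ) - (0 : ℕ)) / 2))⁻¹ = G
  calc _ = β ^ n * G * (1 / 2) * J * ((α * T / 2) ^ ((((0 : ℕ) : ℝ) - (n : ℝ) + 1) / 2)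
      * (T / (2 * α)) ^ (((n : ℝ) - ((0 : ℕ) : ℝ) + 1) / 2)) := by
        simp only [pow_zero, Nat.factorial_zero, Nat.cast_one]
        field_simp
    _ = _ := by
        rw [p1]; field_simp; ring

lemma nig_cn_succ {α β δ τ : ℝ} (k₀ : ℝ) (hα : 0 < α) (hT : 0 < δ * τ) (m n : ℕ) (hn : n ≤ m) :
    cnTermA α β δ τ k₀ (m + 1) n = α * (δ * τ) / (4 * Real.sqrt Real.pi) *
      ((β ^ n / (n.factorial : ℝ) * nigA (α ^ 2 / 4) (δ * τ) (m - n)) *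
        ((-1) ^ m * k₀ ^ (m + 1) / ((m : ℝ) + 1))) := by
  obtain ⟨i, rfl⟩ := Nat.exists_eq_add_of_le hn
  rw [Nat.add_sub_cancel_left]
  unfold cnTermA
  rw [mul_assoc α, nig_bessel]
  set T := δ * τ
  rcases Nat.even_or_odd' i with ⟨j, rfl | rfl⟩
  · rw [nigA_even, show -((n + 2 * j + 1 : ℕ) : ℝ) + 1 = -((n + 2 * j : ℕ) : ℝ) by push_cast; ring,
      show 1 + ((n : ℝ) - ((n + 2 * j + 1 : ℕ) : ℝ)) / 2 = 1 / 2 - (j : ℝ) by push_cast; ring,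
      nig_gamma_half,
      show (((n + 2 * j + 1 : ℕ) : ℝ) - (n : ℝ) + 1) / 2 = ((j + 1 : ℕ) : ℝ) by push_cast; ring,
      show ((n : ℝ) - ((n + 2 * j + 1 : ℕ) : ℝ) + 1) / 2 = -(j : ℝ) by push_cast; ring,
      Real.rpow_natCast, Real.rpow_neg (by positivity), Real.rpow_natCast,
      show -((j + 1 : ℕ) : ℝ) - 1 = -(j : ℝ) - 2 by push_cast; ring]
    have hr : risingFactorial (-((n + 2 * j : ℕ) : ℝ)) n
        = (-1) ^ n * ((n + 2 * j).factorial : ℝ) / ((2 * j).factorial : ℝ) := by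
      rw [← nig_rising_neg, mul_div_cancel_right₀ _ (by positivity)]
    have hs : Real.sqrt Real.pi ≠ 0 := by positivity
    have e1 : (-1 : ℝ) ^ (n + 2 * j) = (-1) ^ n := by rw [pow_add, pow_mul]; simp
    have e2 : (-(α ^ 2 / 4)) ^ j = (-1) ^ j * α ^ (2 * j) / 4 ^ j := by
      rw [neg_pow, div_pow, ← pow_mul]; ring
    have e3 : (α * T / 2) ^ (j + 1) * ((T / (2 * α)) ^ j)⁻¹ = α * T / 2 * α ^ (2 * j) := by
      rw [pow_succ, mul_right_comm, ← div_eq_mul_inv, ← div_pow,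
        show α * T / 2 / (T / (2 * α)) = α ^ 2 by field_simp, ← pow_mul]; ring
    rw [hr, e1, e2, Nat.factorial_succ (n + 2 * j)]
    generalize nigJ (α ^ 2 / 4) T (-(j : ℝ) - 2) = J
    have hf1 : ((n + 2 * j).factorial : ℝ) ≠ 0 := by positivity
    have hf2 : ((2 * j).factorial : ℝ) ≠ 0 := by positivity
    have hf3 : (n.factorial : ℝ) ≠ 0 := by positivity
    have hf4 : (j.factorial : ℝ) ≠ 0 := by positivity
    calc _ = (-1) ^ n * k₀ ^ (n + 2 * j + 1) * β ^ n / (((n + 2 * j : ℕ) : ℝ) + 1) / (n.factorial : ℝ)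
          * ((-1) ^ j / (4 ^ j * (j.factorial : ℝ) * Real.sqrt Real.pi)) * (1 / 2) * J *
          ((α * T / 2) ^ (j + 1) * ((T / (2 * α)) ^ j)⁻¹) := by
            rw [Nat.cast_mul (n + 2 * j + 1), Nat.cast_add_one]
            have : (((n + 2 * j : ℕ) : ℝ) + 1) ≠ 0 := by positivity
            generalize (((n + 2 * j : ℕ) : ℝ) + 1) = q at *
            generalize ((T / (2 * α)) ^ j)⁻¹ = w
            field_simp
      _ = _ := by
            rw [e3]
            field_simp
            ring
  · rw [nigA_odd, show 1 + ((n : ℝ) - ((n + (2 * j + 1) + 1 : ℕ) : ℝ)) / 2 = -(j : ℝ) by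
      push_cast; ring, Real.Gamma_neg_nat_eq_zero]
    simp

lemma nig_cn_large {α β δ τ : ℝ} (k₀ : ℝ) (m n : ℕ) (hn : m < n) :
    cnTermA α β δ τ k₀ (m + 1) n = 0 := by
  unfold cnTermA
  rw [show -((m + 1 : ℕ) : ℝ) + 1 = -(m : ℝ) by push_cast; ring, nig_rising_zero m n hn]
  simp

lemma nig_cn_succ_hasSum {α β δ τ : ℝ} (k₀ : ℝ) (hα : 0 < α) (hT : 0 < δ * τ) (m : ℕ) :
    HasSum (fun n => cnTermA α β δ τ k₀ (m + 1) n) (α * (δ * τ) / (4 * Real.sqrt Real.pi) *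
      (nigC (α ^ 2 / 4) (δ * τ) β m * ((-1) ^ m * k₀ ^ (m + 1) / ((m : ℝ) + 1)))) := by
  have := hasSum_sum_of_ne_finset_zero (L := SummationFilter.unconditional ℕ) (f := fun n => cnTermA α β δ τ k₀ (m + 1) n)
    (s := Finset.range (m + 1)) (fun n hn => nig_cn_large k₀ m n (by simp at hn; omega))
  convert! this using 1
  unfold nigC
  rw [Finset.sum_mul, Finset.mul_sum]
  exact Finset.sum_congr rfl fun n hn =>
    (nig_cn_succ k₀ hα hT m n (by simp at hn; omega)).symm

lemma nig_density (α β δ μ x t : ℝ) (hT : 0 < δ * t) :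
    nigDensityA α β δ μ x t = α ^ 2 * (δ * t) / (4 * Real.pi)
      * Real.exp (Real.sqrt (α ^ 2 - β ^ 2) * δ * t)
      * (Real.exp (β * (x - μ * t)) * nigH (α ^ 2 / 4) (δ * t) (x - μ * t)) := by
  unfold nigDensityA
  set y := x - μ * t
  set R := Real.sqrt ((δ * t) ^ 2 + y ^ 2) with hR
  have hRpos : 0 < R := by positivity
  have hR2 : R ^ 2 = (δ * t) ^ 2 + y ^ 2 := Real.sq_sqrt (by positivity)
  rw [nig_bessel, Real.rpow_one, Real.exp_add]
  have : nigJ (α ^ 2 / 4) R (-1 - 1) = nigH (α ^ 2 / 4) (δ * t) y := by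
    unfold nigJ nigH nigKer
    rw [hR2]; norm_num
  rw [this]
  field_simp
  ring

/-- Cash-or-nothing call pricing formula in the asymmetric exponential NIG model. -/
theorem cash_or_nothing_call_asymmetric
    (α β δ μ S K r q τ : ℝ)
    (hα : 0 < α) (hβl : -α < β) (hβu : β < α - 1) (hβ : β ≠ 0)
    (hδ : 0 < δ) (hS : 0 < S) (hK : 0 < K)
    (hr : 0 ≤ r) (hq : 0 ≤ q) (hτ : 0 < τ)
    (ω k k₀ : ℝ)
    (hω : ω = -μ + δ * (Real.sqrt (α ^ 2 - (β + 1) ^ 2) - Real.sqrt (α ^ 2 - β ^ 2)))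
    (hk : k = Real.log (S / K) + (r - q + ω) * τ)
    (hk₀ : k₀ = k + μ * τ)
    (hconv : |k₀| < δ * τ) :
    (∀ n₁ : ℕ, Summable (fun n₂ : ℕ => cnTermA α β δ τ k₀ n₁ n₂)) ∧
    Summable (fun n₁ : ℕ => ∑' n₂ : ℕ, cnTermA α β δ τ k₀ n₁ n₂) ∧
    Real.exp (-r * τ) *
        (∫ x : ℝ, (if -k < x then (1 : ℝ) else 0) * nigDensityA α β δ μ x τ)
      = α * Real.exp ((Real.sqrt (α ^ 2 - β ^ 2) * δ - r) * τ) / Real.sqrt Real.pi *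
          ∑' n₁ : ℕ, ∑' n₂ : ℕ, cnTermA α β δ τ k₀ n₁ n₂ := by
  have hT : 0 < δ * τ := by positivity
  have hβa : |β| < α := abs_lt.2 ⟨hβl, by linarith⟩
  have hc : 0 < α ^ 2 / 4 := by positivity
  set D := α * (δ * τ) / (4 * Real.sqrt Real.pi) with hD
  set g : ℝ → ℝ := fun y => Real.exp (β * y) * nigH (α ^ 2 / 4) (δ * τ) y with hg
  have h0 : HasSum (fun n => cnTermA α β δ τ k₀ 0 n) (D * ∫ y in Set.Ioi (0 : ℝ), g y) := by
    have := (nig_halfline hα hT hβa).mul_left D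
    convert! this using 2 with n
    exact nig_cn_zero k₀ hα hT n
  have hs := fun m => nig_cn_succ_hasSum (β := β) k₀ hα hT m
  have htail : HasSum (fun m => ∑' n, cnTermA α β δ τ k₀ (m + 1) n)
      (D * ∫ y in (-k₀)..0, g y) := by
    have := (nigC_integral β hc hconv).mul_left D
    convert! this using 2 with m
    exact (hs m).tsum_eq
  have hall : HasSum (fun m => ∑' n, cnTermA α β δ τ k₀ m n)
      (D * ∫ y in Set.Ioi (-k₀), g y) := by
    rw [← hasSum_nat_add_iff' 1]
    convert! htail using 1
    rw [Finset.sum_range_one, h0.tsum_eq,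
      ← intervalIntegral.integral_interval_add_Ioi (nig_g_int hα hT hβa (-k₀))
        (nig_g_int hα hT hβa 0)]
    ring
  refine ⟨?_, hall.summable, ?_⟩
  · rintro (_ | m)
    · exact h0.summable
    · exact (hs m).summable
  · rw [hall.tsum_eq]
    have hintg : (∫ x : ℝ, (if -k < x then (1 : ℝ) else 0) * nigDensityA α β δ μ x τ)
        = α ^ 2 * (δ * τ) / (4 * Real.pi) * Real.exp (Real.sqrt (α ^ 2 - β ^ 2) * δ * τ)
          * ∫ y in Set.Ioi (-k₀), g y := by
      rw [← integral_indicator measurableSet_Ioi,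
        ← integral_sub_right_eq_self ((Set.Ioi (-k₀)).indicator g) (μ * τ), ← integral_const_mul]
      congr 1
      ext x
      rw [nig_density _ _ _ _ _ _ hT]
      have hiff : (x - μ * τ ∈ Set.Ioi (-k₀)) ↔ -k < x := by
        rw [Set.mem_Ioi, hk₀]; constructor <;> intro h <;> linarith
      by_cases hx : -k < x
      · rw [Set.indicator_of_mem (hiff.2 hx), if_pos hx, one_mul]
      · rw [Set.indicator_of_notMem (fun h => hx (hiff.1 h)), if_neg hx]; ring
    rw [hintg, show (Real.sqrt (α ^ 2 - β ^ 2) * δ - r) * τ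
      = -r * τ + Real.sqrt (α ^ 2 - β ^ 2) * δ * τ by ring, Real.exp_add, hD]
    have hpi : Real.pi = Real.sqrt Real.pi * Real.sqrt Real.pi :=
      (Real.mul_self_sqrt Real.pi_pos.le).symm
    have hs0 : Real.sqrt Real.pi ≠ 0 := by positivity
    generalize (∫ y in Set.Ioi (-k₀), g y) = I
    generalize hsq : Real.sqrt Real.pi = s at *
    rw [hpi]
    field_simp
end
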